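/- arXiv:2506.16283 — 2 statements merged into one kernel-verified Lean document; each statement's English description precedes it below -/
import Mathlib

section
/- Let A and B be positive self-adjoint bounded linear operators on a separable Hilbert space and let s ∈ [0,1]. Then ‖A^s B^s‖ ≤ ‖AB‖^s. -/
section CordesAux

open scoped NNReal

variable {A : Type*} [CStarAlgebra A] [PartialOrder A] [StarOrderedRing A]

lemma cordes_smul_rpow (r : ℝ≥0) (a : A) (ha : 0 ≤ a) (s : ℝ) (hs : 0 ≤ s) :
    (r • a) ^ s = (r ^ s) • a ^ s := by
  rw [CFC.rpow_def, CFC.rpow_def, ← cfc_comp_smul r (fun x : ℝ≥0 => x ^ s) a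
    ((NNReal.continuous_rpow_const hs).continuousOn) ha, ← cfc_smul (r ^ s) (fun x : ℝ≥0 => x ^ s) a
    ((NNReal.continuous_rpow_const hs).continuousOn)]
  simp [NNReal.mul_rpow]

lemma cordes_sq (a b : A) (ha : 0 ≤ a) (hb : 0 ≤ b) : ‖a * b‖ ^ 2 = ‖b * (a * a) * b‖ := by
  have h := CStarRing.norm_star_mul_self (x := a * b)
  rw [star_mul, ha.star_eq, hb.star_eq] at h
  rw [pow_two, ← h]; simp only [mul_assoc]

lemma cordes_pow_mul (a : A) (ha : 0 ≤ a) (s : ℝ) (hs : 0 ≤ s) : (a * a) ^ s = a ^ s * a ^ s := by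
  have h : a * a = a ^ (2 : ℝ) := by
    have := CFC.rpow_natCast a 2
    rw [← pow_two, ← this]; norm_num
  rw [h, CFC.rpow_rpow_of_exponent_nonneg a 2 s (by norm_num) hs, CFC.rpow_def, CFC.rpow_def,
    ← cfc_mul _ _ a ((NNReal.continuous_rpow_const hs).continuousOn)
      ((NNReal.continuous_rpow_const hs).continuousOn)]
  congr 1; ext x
  rw [two_mul, NNReal.rpow_add_of_nonneg _ hs hs]

lemma cordes_unit (a b : A) (ha : 0 ≤ a) (hb : IsStrictlyPositive b) (s : ℝ)
    (hs : s ∈ Set.Icc (0 : ℝ) 1) : ‖a ^ s * b ^ s‖ ≤ ‖a * b‖ ^ s := by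
  have hb0 := hb.nonneg
  set i : A := b ^ (-1 : ℝ) with hi
  have hi0 : 0 ≤ i := CFC.rpow_nonneg
  have hbi : b * i = 1 := by simpa [CFC.rpow_one b] using CFC.rpow_mul_rpow_neg (a := b) 1 hb
  have hib : i * b = 1 := by simpa [CFC.rpow_one b] using CFC.rpow_neg_mul_rpow (a := b) 1 hb
  have his : i ^ s = b ^ (-s) := by
    rw [hi, CFC.rpow_rpow b _ _ (by norm_num)]; simp
  have h1 : b ^ s * i ^ s = 1 := by rw [his, CFC.rpow_mul_rpow_neg]
  have h2 : i ^ s * b ^ s = 1 := by rw [his, CFC.rpow_neg_mul_rpow]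
  have haa : 0 ≤ a * a := by simpa [ha.star_eq] using star_mul_self_nonneg a
  have hii : 0 ≤ i * i := by simpa [hi0.star_eq] using star_mul_self_nonneg i
  have hx : 0 ≤ b * (a * a) * b := by simpa [hb0.star_eq] using star_left_conjugate_nonneg haa b
  set r : ℝ≥0 := ‖a * b‖₊ ^ 2 with hr
  have hle : b * (a * a) * b ≤ r • (1 : A) := by
    have := IsSelfAdjoint.le_algebraMap_norm_self (a := b * (a * a) * b) hx.isSelfAdjoint
    rw [← cordes_sq a b ha hb0, Algebra.algebraMap_eq_smul_one] at this
    exact this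
  have h3 : a * a ≤ r • (i * i) := by
    have := star_left_conjugate_le_conjugate hle i
    rw [hi0.star_eq] at this
    calc a * a = (i * b) * (a * a) * (b * i) := by rw [hib, hbi]; simp
      _ = i * (b * (a * a) * b) * i := by simp only [mul_assoc]
      _ ≤ _ := this
      _ = _ := by simp
  have h4 := CFC.rpow_le_rpow hs h3
  rw [cordes_smul_rpow r _ hii s hs.1, cordes_pow_mul a ha s hs.1, cordes_pow_mul i hi0 s hs.1] at h4
  have hbs : 0 ≤ b ^ s := CFC.rpow_nonneg
  have has : 0 ≤ a ^ s := CFC.rpow_nonneg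
  have h5 := star_left_conjugate_le_conjugate h4 (b ^ s)
  rw [hbs.star_eq] at h5
  have h6 : b ^ s * (r ^ s • (i ^ s * i ^ s)) * b ^ s = r ^ s • (1 : A) := by
    rw [mul_smul_comm, smul_mul_assoc, ← mul_assoc, h1, one_mul, h2]
  rw [h6] at h5
  have hss : 0 ≤ a ^ s * a ^ s := by simpa [has.star_eq] using star_mul_self_nonneg (a ^ s)
  have h7 : ‖b ^ s * (a ^ s * a ^ s) * b ^ s‖ ≤ (r ^ s : ℝ≥0) := by
    rw [CStarAlgebra.norm_le_iff_le_algebraMap _ (by positivity)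
      (by simpa [hbs.star_eq] using star_left_conjugate_nonneg hss (b ^ s)),
      Algebra.algebraMap_eq_smul_one]
    exact h5
  rw [← cordes_sq _ _ has hbs] at h7
  refine le_of_sq_le_sq ?_ (by positivity)
  refine h7.trans_eq ?_
  rw [hr]; push_cast
  rw [← Real.rpow_natCast, ← Real.rpow_natCast, ← Real.rpow_mul (by simp), ← Real.rpow_mul (by simp), mul_comm]

lemma cordes (a b : A) (ha : 0 ≤ a) (hb : 0 ≤ b) (s : ℝ)
    (hs : s ∈ Set.Icc (0 : ℝ) 1) : ‖a ^ s * b ^ s‖ ≤ ‖a * b‖ ^ s := by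
  have key : ∀ e : ℝ≥0, 0 < e → ‖a ^ s * b ^ s‖ ≤ ‖a * (b + e • (1 : A))‖ ^ s := by
    intro e he
    have he1 : IsStrictlyPositive (e • (1 : A)) := by
      rw [IsStrictlyPositive.iff_of_unital]
      refine ⟨smul_nonneg (by positivity) zero_le_one, ?_⟩
      have := (IsUnit.mk0 e he.ne').map (algebraMap ℝ≥0 A)
      rwa [Algebra.algebraMap_eq_smul_one] at this
    have hsp : IsStrictlyPositive (b + e • (1 : A)) :=
      IsStrictlyPositive.nonneg_add hb he1
    refine le_trans ?_ (cordes_unit a _ ha hsp s hs)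
    set c := b + e • (1 : A) with hc
    have hc0 := hsp.nonneg
    have h1 : b * b ≤ c * c := by
      have : c * c = b * b + ((2 * e) • b + (e * e) • (1 : A)) := by
        rw [hc]; simp [add_mul, mul_add, two_mul, add_smul, smul_smul]; abel
      rw [this]
      exact le_add_of_nonneg_right (add_nonneg (smul_nonneg (by positivity) hb)
        (smul_nonneg (by positivity) zero_le_one))
    have h2 := CFC.rpow_le_rpow hs h1
    rw [cordes_pow_mul b hb s hs.1, cordes_pow_mul c hc0 s hs.1] at h2
    have hbs : 0 ≤ b ^ s := CFC.rpow_nonneg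
    have hcs : 0 ≤ c ^ s := CFC.rpow_nonneg
    have has : 0 ≤ a ^ s := CFC.rpow_nonneg
    have h3 := star_left_conjugate_le_conjugate h2 (a ^ s)
    have h0 : 0 ≤ star (a ^ s) * (b ^ s * b ^ s) * a ^ s :=
      star_left_conjugate_nonneg (by simpa [hbs.star_eq] using star_mul_self_nonneg (b ^ s)) _
    have h4 := CStarAlgebra.norm_le_norm_of_nonneg_of_le h0 h3
    rw [has.star_eq, ← cordes_sq _ _ hbs has, ← cordes_sq _ _ hcs has] at h4
    have h5 := le_of_sq_le_sq h4 (by positivity)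
    have sw : ∀ x y : A, 0 ≤ x → 0 ≤ y → ‖x * y‖ = ‖y * x‖ := fun x y hx hy => by
      rw [← norm_star, star_mul, hx.star_eq, hy.star_eq]
    rwa [sw _ _ hbs has, sw _ _ hcs has] at h5
  have hcont : Continuous (fun e : ℝ≥0 => ‖a * (b + e • (1 : A))‖ ^ s) :=
    Continuous.rpow_const (by fun_prop) (fun _ => Or.inr hs.1)
  have ht := (hcont.tendsto 0).mono_left (nhdsWithin_le_nhds (s := Set.Ioi 0))
  simp only [zero_smul, add_zero] at ht
  exact ge_of_tendsto ht (Filter.eventually_of_mem self_mem_nhdsWithin fun e he => key e he)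

end CordesAux

open ContinuousLinearMap in
/-- **Cordes inequality.** For positive self-adjoint bounded operators `A, B` on a
separable Hilbert space and `s ∈ [0,1]`, `‖A^s B^s‖ ≤ ‖A B‖^s`, where operator powers are given
by the continuous functional calculus. -/
theorem statement11
    {H : Type*} [NormedAddCommGroup H] [InnerProductSpace ℂ H] [CompleteSpace H]
    [SecondCountableTopology H]
    (A B : H →L[ℂ] H) (hA : 0 ≤ A) (hB : 0 ≤ B)
    (hAsa : IsSelfAdjoint A) (hBsa : IsSelfAdjoint B)
    (s : ℝ) (hs : s ∈ Set.Icc (0 : ℝ) 1) :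
    ‖CFC.rpow A s ∘L CFC.rpow B s‖ ≤ ‖A ∘L B‖ ^ s := by
  exact cordes A B hA hB s hs
end

section
/- Let A and B be positive self-adjoint bounded linear operators on a separable Hilbert space, let λ > 0, and let q ∈ [0,1/2]. Then ‖(A + λI)^{−q}(B + λI)^{q}‖ ≤ ‖(A + λI)^{−1/2}(B + λI)^{1/2}‖^{2q}. -/
open scoped NNReal in
lemma smul_rpow_aux {R : Type*} [CStarAlgebra R] [PartialOrder R] [StarOrderedRing R]
    (a : R) (ha : 0 ≤ a) (r : ℝ≥0) (p : ℝ) (hp : 0 ≤ p) :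
    (r • a) ^ p = (r ^ p : ℝ≥0) • a ^ p := by
  have hc : ∀ s : Set ℝ≥0, ContinuousOn (fun x : ℝ≥0 => x ^ p) s := fun s =>
    (NNReal.continuous_rpow_const hp).continuousOn
  rw [CFC.rpow_def, CFC.rpow_def, ← cfc_comp_smul r (fun x : ℝ≥0 => x ^ p) a (hc _) ha,
    ← cfc_smul (r ^ p : ℝ≥0) (fun x : ℝ≥0 => x ^ p) a (hc _)]
  congr 1
  ext x
  simp [NNReal.mul_rpow]

lemma norm_sq_aux {R : Type*} [CStarAlgebra R] [PartialOrder R] [StarOrderedRing R]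
    (X Y : R) (hY : IsStrictlyPositive Y) (s : ℝ) :
    (X ^ (-s) * Y ^ s) * star (X ^ (-s) * Y ^ s) = X ^ (-s) * Y ^ (2 * s) * X ^ (-s) := by
  have h1 : star (X ^ (-s)) = X ^ (-s) := (IsSelfAdjoint.of_nonneg CFC.rpow_nonneg).star_eq
  have h2 : star (Y ^ s) = Y ^ s := (IsSelfAdjoint.of_nonneg CFC.rpow_nonneg).star_eq
  rw [star_mul, h1, h2, two_mul, CFC.rpow_add hY.isUnit]
  simp only [mul_assoc]

open scoped NNReal in
lemma cordes_aux {R : Type*} [CStarAlgebra R] [PartialOrder R] [StarOrderedRing R]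
    (X Y : R) (hX : IsStrictlyPositive X) (hY : IsStrictlyPositive Y)
    (q : ℝ) (hq : q ∈ Set.Icc (0 : ℝ) (1/2)) :
    ‖X ^ (-q) * Y ^ q‖ ≤ ‖X ^ (-(1/2) : ℝ) * Y ^ (1/2 : ℝ)‖ ^ (2 * q) := by
  set T := X ^ (-(1/2) : ℝ) * Y ^ (1/2 : ℝ) with hT
  have hq0 : 0 ≤ 2 * q := by linarith [hq.1]
  have key : ∀ s : ℝ, X ^ s * (X ^ (-s) * Y ^ (2 * s) * X ^ (-s)) * X ^ s = Y ^ (2 * s) := by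
    intro s
    calc _ = (X ^ s * X ^ (-s)) * Y ^ (2 * s) * (X ^ (-s) * X ^ s) := by simp only [mul_assoc]
      _ = _ := by rw [CFC.rpow_mul_rpow_neg s hX, CFC.rpow_neg_mul_rpow s hX, one_mul, mul_one]
  have hsa : ∀ s : ℝ, IsSelfAdjoint (X ^ s) := fun s => .of_nonneg CFC.rpow_nonneg
  have h1 : T * star T ≤ algebraMap ℝ R (‖T‖ ^ 2) := CStarAlgebra.mul_star_le_algebraMap_norm_sq
  have h2 : Y ≤ (‖T‖₊ ^ 2) • X := by
    rw [hT, norm_sq_aux X Y hY, ← hT] at h1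
    have := (hsa (1/2)).conjugate_le_conjugate h1
    rw [key (1/2), Algebra.algebraMap_eq_smul_one, mul_smul_comm, mul_one, smul_mul_assoc,
      ← CFC.rpow_add hX.isUnit] at this
    norm_num at this
    rw [CFC.rpow_one Y hY.nonneg, CFC.rpow_one X hX.nonneg] at this
    exact this
  have h3 : Y ^ (2 * q) ≤ ((‖T‖₊ ^ 2) ^ (2 * q) : ℝ≥0) • X ^ (2 * q) := by
    rw [← smul_rpow_aux X hX.nonneg _ _ hq0]
    exact CFC.rpow_le_rpow ⟨hq0, by linarith [hq.2]⟩ h2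
  have h4 := (hsa (-q)).conjugate_le_conjugate h3
  have h5 : X ^ (-q) * X ^ (2 * q) * X ^ (-q) = 1 := by
    rw [← CFC.rpow_add hX.isUnit, ← CFC.rpow_add hX.isUnit, ← CFC.rpow_zero X hX.nonneg]
    congr 1; ring
  rw [mul_smul_comm, smul_mul_assoc, h5, ← norm_sq_aux X Y hY, ← Algebra.algebraMap_eq_smul_one,
    ← CStarAlgebra.nnnorm_le_iff_of_nonneg _ _ (mul_star_self_nonneg _),
    CStarRing.nnnorm_self_mul_star] at h4
  have h6 : ‖X ^ (-q) * Y ^ q‖₊ ≤ ‖T‖₊ ^ (2 * q) := by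
    rw [← pow_two, ← NNReal.rpow_natCast ‖T‖₊ 2, ← NNReal.rpow_mul, mul_comm, NNReal.rpow_mul,
      NNReal.rpow_natCast] at h4
    exact (pow_le_pow_iff_left₀ zero_le zero_le two_ne_zero).1 h4
  exact_mod_cast h6

open ContinuousLinearMap in
/-- For positive self-adjoint bounded operators `A, B` on a separable Hilbert
space, `λ > 0` and `q ∈ [0,1/2]`,
`‖(A + λI)^{-q} (B + λI)^{q}‖ ≤ ‖(A + λI)^{-1/2} (B + λI)^{1/2}‖^{2q}`,
where all (possibly negative) operator powers are given by the continuous functional calculus. -/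
theorem statement12
    {H : Type*} [NormedAddCommGroup H] [InnerProductSpace ℂ H] [CompleteSpace H]
    [SecondCountableTopology H]
    (A B : H →L[ℂ] H) (hA : 0 ≤ A) (hB : 0 ≤ B)
    (hAsa : IsSelfAdjoint A) (hBsa : IsSelfAdjoint B)
    (lam : ℝ) (hlam : 0 < lam) (q : ℝ) (hq : q ∈ Set.Icc (0 : ℝ) (1/2)) :
    ‖CFC.rpow (A + (lam : ℂ) • (1 : H →L[ℂ] H)) (-q) ∘L
        CFC.rpow (B + (lam : ℂ) • (1 : H →L[ℂ] H)) q‖ ≤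
      ‖CFC.rpow (A + (lam : ℂ) • (1 : H →L[ℂ] H)) (-(1/2) : ℝ) ∘L
          CFC.rpow (B + (lam : ℂ) • (1 : H →L[ℂ] H)) (1/2 : ℝ)‖ ^ (2 * q) := by
  have hc : IsStrictlyPositive ((lam : ℂ) • (1 : H →L[ℂ] H)) := by
    have h0 : (0 : H →L[ℂ] H) ≤ lam • (1 : H →L[ℂ] H) := smul_nonneg hlam.le zero_le_one
    refine ⟨by rwa [Complex.coe_smul], ?_⟩
    exact isUnit_one.smul (Units.mk0 (lam : ℂ) (by exact_mod_cast hlam.ne'))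
  exact cordes_aux _ _ (hc.nonneg_add hA) (hc.nonneg_add hB) q hq
end
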